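/- Let A ∈ ℝ_+^{m×n×p} be co-(r1,r2)-separable, witnessed by index sets I ⊆ {1,…,m}, J ⊆ {1,…,n} with |I| = r1, |J| = r2 and nonnegative tensors P1, P2 with (P1)_{I::} = I_{r1}, (P2)_{:J:} = I_{r2} and A = P1 * A_{IJ:} * P2. Then for every tensor G ∈ ℝ^{r2×r1×p} satisfying A_{IJ:} * G * A_{IJ:} = A_{IJ:}, one has the exact t-CUR decomposition A = A_{:J:} * G * A_{I::}, where A_{:J:} is the lateral subtensor of A with second indices in J and A_{I::} is the horizontal subtensor with first indices in I. -/

import Mathlib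

open Matrix BigOperators Kronecker

namespace CoSepNTF

noncomputable section

variable {p : ℕ}

/-- The t-product of third-order tensors, represented by their `Fin p`-indexed frontal
slices: `(A * B)_{::s} = ∑ t, A_{::(s-t mod p)} ⬝ B_{::t}`, which is exactly
`fold (bcirc A ⬝ unfold B)`. -/
def tprod {α β γ : Type*} [Fintype β] (A : Fin p → Matrix α β ℝ)
    (B : Fin p → Matrix β γ ℝ) : Fin p → Matrix α γ ℝ :=
  fun s => ∑ t : Fin p, A (s - t) * B t

/-- The identity tensor: first frontal slice the identity, other slices zero. -/
def tId (n p : ℕ) [NeZero p] : Fin p → Matrix (Fin n) (Fin n) ℝ :=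
  fun k => if k = 0 then 1 else 0

/-- Tensor transpose: `(Aᵀ)_{::k} = (A_{::(p-k+2)})ᵀ` (1-based), i.e. slice `-k` (0-based). -/
def tT {α β : Type*} [NeZero p] (A : Fin p → Matrix α β ℝ) : Fin p → Matrix β α ℝ :=
  fun k => (A (-k))ᵀ

/-- A tensor is nonnegative if all its entries are nonnegative. -/
def Nonneg {α β : Type*} (A : Fin p → Matrix α β ℝ) : Prop := ∀ k i j, 0 ≤ A k i j

/-- Horizontal subtensor `A_{I::}` given by a row-selection map `ι`. -/
def rsub {α α' β : Type*} (ι : α' → α) (A : Fin p → Matrix α β ℝ) : Fin p → Matrix α' β ℝ :=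
  fun k => (A k).submatrix ι id

/-- Lateral subtensor `A_{:J:}` given by a column-selection map `κ`. -/
def csub {α β β' : Type*} (κ : β' → β) (A : Fin p → Matrix α β ℝ) : Fin p → Matrix α β' ℝ :=
  fun k => (A k).submatrix id κ

/-- Subtensor `A_{IJ:}`. -/
def coreSub {α α' β β' : Type*} (ι : α' → α) (κ : β' → β) (A : Fin p → Matrix α β ℝ) :
    Fin p → Matrix α' β' ℝ := fun k => (A k).submatrix ι κ

/-- `A` is co-(r1,r2)-separable with core `A_{IJ:}` for the index sets given by `ι, κ`. -/
def CoseparableWithCore {m n r1 r2 : ℕ} [NeZero p] (ι : Fin r1 → Fin m) (κ : Fin r2 → Fin n)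
    (A : Fin p → Matrix (Fin m) (Fin n) ℝ) : Prop :=
  ∃ (P1 : Fin p → Matrix (Fin m) (Fin r1) ℝ) (P2 : Fin p → Matrix (Fin r2) (Fin n) ℝ),
    Nonneg P1 ∧ Nonneg P2 ∧ rsub ι P1 = tId r1 p ∧ csub κ P2 = tId r2 p ∧
    A = tprod (tprod P1 (coreSub ι κ A)) P2

/-- `A` is co-(r1,r2)-separable. -/
def Coseparable {m n : ℕ} [NeZero p] (r1 r2 : ℕ) (A : Fin p → Matrix (Fin m) (Fin n) ℝ) : Prop :=
  ∃ (ι : Fin r1 → Fin m) (κ : Fin r2 → Fin n),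
    Function.Injective ι ∧ Function.Injective κ ∧ CoseparableWithCore ι κ A

/-- A permutation tensor: first frontal slice a permutation matrix, other slices zero. -/
def IsPermTensor {n : ℕ} [NeZero p] (Q : Fin p → Matrix (Fin n) (Fin n) ℝ) : Prop :=
  (∃ σ : Equiv.Perm (Fin n), Q 0 = σ.permMatrix ℝ) ∧ ∀ k, k ≠ 0 → Q k = 0

/-- 2×2 block tensor `[[A11, A12],[A21, A22]]` of size `m × n × p` (where `r1 ≤ m`, `r2 ≤ n`),
formed by block concatenation of each frontal slice. -/
def blockT {m n r1 r2 : ℕ} (hm : r1 ≤ m) (hn : r2 ≤ n)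
    (A11 : Fin p → Matrix (Fin r1) (Fin r2) ℝ)
    (A12 : Fin p → Matrix (Fin r1) (Fin (n - r2)) ℝ)
    (A21 : Fin p → Matrix (Fin (m - r1)) (Fin r2) ℝ)
    (A22 : Fin p → Matrix (Fin (m - r1)) (Fin (n - r2)) ℝ) :
    Fin p → Matrix (Fin m) (Fin n) ℝ :=
  fun k => (Matrix.fromBlocks (A11 k) (A12 k) (A21 k) (A22 k)).submatrix
    (fun i => finSumFinEquiv.symm (Fin.cast (Nat.add_sub_cancel' hm).symm i))
    (fun j => finSumFinEquiv.symm (Fin.cast (Nat.add_sub_cancel' hn).symm j))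

/-- The block circulant matrix of a tensor: block `(s,t)` is `A_{::((s-t) mod p)}`. -/
def bcirc {α β : Type*} (A : Fin p → Matrix α β ℝ) : Matrix (Fin p × α) (Fin p × β) ℝ :=
  Matrix.of fun si tj => A (si.1 - tj.1) si.2 tj.2

/-- The unfolding of a tensor into a block-column matrix. -/
def unfoldT {α β : Type*} (A : Fin p → Matrix α β ℝ) : Matrix (Fin p × α) β ℝ :=
  Matrix.of fun ki j => A ki.1 ki.2 j

/-- Squared Frobenius norm of a real tensor. -/
def frobSq {α β : Type*} [Fintype α] [Fintype β] (A : Fin p → Matrix α β ℝ) : ℝ :=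
  ∑ k, ∑ i, ∑ j, (A k i j) ^ 2

/-- Squared Frobenius norm of a complex tensor. -/
def frobSqC {α β : Type*} [Fintype α] [Fintype β] (A : Fin p → Matrix α β ℂ) : ℝ :=
  ∑ k, ∑ i, ∑ j, ‖A k i j‖ ^ 2

/-- Squared Frobenius norm of a real matrix. -/
def matFrobSq {α β : Type*} [Fintype α] [Fintype β] (M : Matrix α β ℝ) : ℝ :=
  ∑ i, ∑ j, (M i j) ^ 2

/-- The discrete Fourier transform of a tensor along the third dimension:
`Â_{::k} = ∑ j, ω_p^(jk) A_{::j}` with `ω_p = exp(-2πi/p)`. -/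
def fft {α β : Type*} (A : Fin p → Matrix α β ℝ) : Fin p → Matrix α β ℂ :=
  fun k => ∑ j : Fin p,
    (Complex.exp (-2 * (Real.pi : ℂ) * Complex.I / (p : ℂ)) ^ ((j : ℕ) * (k : ℕ))) •
      (A j).map Complex.ofReal

/-- The spectral (ℓ²-operator) norm of a complex matrix. -/
def specNorm {α β : Type*} [Fintype α] [Fintype β] [DecidableEq β] (M : Matrix α β ℂ) : ℝ :=
  ‖LinearMap.toContinuousLinearMap (Matrix.toEuclideanLin M)‖

/-- The tensor spectral norm: `‖A‖₂ = max_k ‖Â_{::k}‖₂`. -/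
def tSpecNorm {α β : Type*} [Fintype α] [Fintype β] [DecidableEq β]
    (A : Fin p → Matrix α β ℝ) : ℝ :=
  ⨆ k, specNorm (fft A k)

/-- The unitary DFT matrix `F_p = (1/√p)(ω_p^{jk})`. -/
def dftMatrix (p : ℕ) : Matrix (Fin p) (Fin p) ℂ :=
  Matrix.of fun j k =>
    (((Real.sqrt p)⁻¹ : ℝ) : ℂ) *
      Complex.exp (-2 * (Real.pi : ℂ) * Complex.I / (p : ℂ)) ^ ((j : ℕ) * (k : ℕ))

/-- The block diagonal matrix `diag(Â_{::1}, …, Â_{::p})`. -/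
def fftBD {α β : Type*} (A : Fin p → Matrix α β ℝ) : Matrix (Fin p × α) (Fin p × β) ℂ :=
  Matrix.of fun ki lj => if ki.1 = lj.1 then fft A ki.1 ki.2 lj.2 else 0

/-- The square of the smallest nonzero singular value of `M`, i.e. the smallest nonzero
eigenvalue of `Mᴴ * M`. -/
def sigmaMinSq {α β : Type*} [Fintype α] [Fintype β] (M : Matrix α β ℂ) : ℝ :=
  sInf {t : ℝ | t ≠ 0 ∧ ∃ v : β → ℂ, v ≠ 0 ∧ (Mᴴ * M) *ᵥ v = (t : ℂ) • v}


theorem tprod_assoc {α β γ δ : Type*} [Fintype β] [Fintype γ] [NeZero p]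
    (A : Fin p → Matrix α β ℝ) (B : Fin p → Matrix β γ ℝ) (C : Fin p → Matrix γ δ ℝ) :
    tprod (tprod A B) C = tprod A (tprod B C) := by
  funext s
  simp only [tprod, Matrix.sum_mul, Matrix.mul_sum]
  conv_rhs => rw [Finset.sum_comm]
  refine Finset.sum_congr rfl fun t _ => ?_
  rw [← Equiv.sum_comp (Equiv.subRight t)
    (fun u => A (s - t - u) * B u * C t)]
  refine Finset.sum_congr rfl fun u _ => ?_
  simp [Matrix.mul_assoc]

theorem rsub_tprod {α α' β γ : Type*} [Fintype β] (ι : α' → α)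
    (A : Fin p → Matrix α β ℝ) (B : Fin p → Matrix β γ ℝ) :
    rsub ι (tprod A B) = tprod (rsub ι A) B := by
  funext s
  ext i j
  simp [rsub, tprod, Matrix.sum_apply, Matrix.mul_apply]

theorem csub_tprod {α β γ γ' : Type*} [Fintype β] (κ : γ' → γ)
    (A : Fin p → Matrix α β ℝ) (B : Fin p → Matrix β γ ℝ) :
    csub κ (tprod A B) = tprod A (csub κ B) := by
  funext s
  ext i j
  simp [csub, tprod, Matrix.sum_apply, Matrix.mul_apply]

theorem tId_tprod {n : ℕ} {γ : Type*} [NeZero p] (B : Fin p → Matrix (Fin n) γ ℝ) :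
    tprod (tId n p) B = B := by
  funext s
  rw [tprod, Finset.sum_eq_single s] <;> simp +contextual [tId, sub_eq_zero, eq_comm]

theorem tprod_tId {n : ℕ} {α : Type*} [NeZero p] (A : Fin p → Matrix α (Fin n) ℝ) :
    tprod A (tId n p) = A := by
  funext s
  rw [tprod, Finset.sum_eq_single 0] <;> simp +contextual [tId]

/-- Theorem 3.5 (i): a co-(r1,r2)-separable tensor admits an exact t-CUR
decomposition: if `A = P1 * A_{IJ:} * P2` is a coseparable factorization, then for any
inner inverse `G` of the core (`A_{IJ:} * G * A_{IJ:} = A_{IJ:}`, e.g. the Moore–Penrose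
pseudoinverse) one has `A = A_{:J:} * G * A_{I::}`. -/
theorem tCUR_of_coseparable {m n p r1 r2 : ℕ} [NeZero p]
    (A : Fin p → Matrix (Fin m) (Fin n) ℝ) (hA : Nonneg A)
    (ι : Fin r1 → Fin m) (κ : Fin r2 → Fin n)
    (hι : Function.Injective ι) (hκ : Function.Injective κ)
    (P1 : Fin p → Matrix (Fin m) (Fin r1) ℝ) (P2 : Fin p → Matrix (Fin r2) (Fin n) ℝ)
    (hP1 : Nonneg P1) (hP2 : Nonneg P2)
    (hP1I : rsub ι P1 = tId r1 p) (hP2J : csub κ P2 = tId r2 p)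
    (hfac : A = tprod (tprod P1 (coreSub ι κ A)) P2)
    (G : Fin p → Matrix (Fin r2) (Fin r1) ℝ)
    (hG : tprod (tprod (coreSub ι κ A) G) (coreSub ι κ A) = coreSub ι κ A) :
    A = tprod (tprod (csub κ A) G) (rsub ι A) := by
  have hC : csub κ A = tprod P1 (coreSub ι κ A) := by
    conv_lhs => rw [hfac]
    rw [csub_tprod, hP2J, tprod_tId]
  have hR : rsub ι A = tprod (coreSub ι κ A) P2 := by
    conv_lhs => rw [hfac]
    rw [rsub_tprod, rsub_tprod, hP1I, tId_tprod]
  rw [hC, hR, ← tprod_assoc, tprod_assoc P1, tprod_assoc P1, hG]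
  exact hfac

end

end CoSepNTF
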